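/- arXiv:2108.04268 — 2 statements merged into one kernel-verified Lean document; each statement's English description precedes it below -/
import Mathlib

section
/- Let μ be a centered probability measure on ℝ whose support is an infinite set and all of whose moments are finite, and fix d ∈ ℕ. Then there exists a constant C > 0, depending only on μ and d, such that for every n ∈ ℕ and every polynomial f : ℝⁿ → ℝ of degree at most d, the variance of f with respect to the product measure μ^⊗n satisfies Var_{μ^⊗n}(f) ≥ C · coeff_d(f)². -/
open MeasureTheory

/-- The `d`-level content of a multivariate polynomial: the square root of the sum of the
squares of the coefficients of the monomials of total degree `d`. -/
noncomputable def coeffd {n : ℕ} (d : ℕ) (f : MvPolynomial (Fin n) ℝ) : ℝ :=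
  Real.sqrt (∑ m ∈ f.support.filter (fun m => (∑ i, m i) = d), f.coeff m ^ 2)

section OneVariable

variable {μ : Measure ℝ}

lemma integrable_polynomial_eval (hmoments : ∀ k : ℕ, Integrable (fun x : ℝ => x ^ k) μ)
    (q : Polynomial ℝ) : Integrable (fun x => q.eval x) μ := by
  simp_rw [Polynomial.eval_eq_sum_range]
  exact integrable_finsetSum _ fun k _ => (hmoments k).const_mul _

lemma integral_polynomial_sq_pos (hmoments : ∀ k : ℕ, Integrable (fun x : ℝ => x ^ k) μ)
    (hsupp : {x : ℝ | ∀ U ∈ nhds x, μ U ≠ 0}.Infinite) {q : Polynomial ℝ} (hq : q ≠ 0) :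
    0 < ∫ x, (q * q).eval x ∂μ := by
  have hnonneg : 0 ≤ fun x => (q * q).eval x := fun x => by
    simpa using mul_self_nonneg (q.eval x)
  refine lt_of_le_of_ne (integral_nonneg hnonneg) fun h => hsupp ?_
  have hae := (integral_eq_zero_iff_of_nonneg hnonneg
    (integrable_polynomial_eval hmoments _)).1 h.symm
  refine (q.roots.toFinset.finite_toSet).subset fun x hx => ?_
  by_contra hroot
  have hx0 : q.eval x ≠ 0 := by simpa [hq] using hroot
  refine hx {y | q.eval y ≠ 0} (q.continuous.continuousAt.eventually_ne hx0) ?_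
  refine measure_mono_null (fun y hy => ?_) (ae_iff.1 hae)
  simpa using hy

/-- The bilinear form `(q, r) ↦ ∫ q r dμ` on polynomials. -/
noncomputable def polynomialInner (hmoments : ∀ k : ℕ, Integrable (fun x : ℝ => x ^ k) μ) :
    Polynomial ℝ →ₗ[ℝ] Polynomial ℝ →ₗ[ℝ] ℝ :=
  LinearMap.mk₂ ℝ (fun q r => ∫ x, (q * r).eval x ∂μ)
    (fun q₁ q₂ r => by
      simp only [add_mul, Polynomial.eval_add]
      exact integral_add (integrable_polynomial_eval hmoments _)
        (integrable_polynomial_eval hmoments _))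
    (fun c q r => by
      simp only [smul_mul_assoc, Polynomial.eval_smul]
      exact integral_smul _ _)
    (fun q r₁ r₂ => by
      simp only [mul_add, Polynomial.eval_add]
      exact integral_add (integrable_polynomial_eval hmoments _)
        (integrable_polynomial_eval hmoments _))
    (fun c q r => by
      simp only [mul_smul_comm, Polynomial.eval_smul]
      exact integral_smul _ _)

lemma exists_monic_orthogonal (hmoments : ∀ k : ℕ, Integrable (fun x : ℝ => x ^ k) μ)
    (hsupp : {x : ℝ | ∀ U ∈ nhds x, μ U ≠ 0}.Infinite) (k : ℕ) :
    ∃ p : Polynomial ℝ, p.Monic ∧ p.natDegree = k ∧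
      ∀ q : Polynomial ℝ, q.degree < k → ∫ x, (q * p).eval x ∂μ = 0 := by
  set V := Polynomial.degreeLT ℝ k
  have : FiniteDimensional ℝ V :=
    LinearEquiv.finiteDimensional (Polynomial.degreeLTEquiv ℝ k).symm
  set T : V →ₗ[ℝ] Module.Dual ℝ V := (polynomialInner hmoments).domRestrict₁₂ V V
  have hT : Function.Injective T := by
    refine (injective_iff_map_eq_zero T).2 fun v hv => ?_
    by_contra hne
    have hpos := integral_polynomial_sq_pos hmoments hsupp (q := v) (by simpa using hne)
    have hzero : T v v = 0 := by rw [hv]; rfl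
    exact hpos.ne' hzero
  have hsurj : Function.Surjective T :=
    (LinearMap.injective_iff_surjective_of_finrank_eq_finrank
      Subspace.dual_finrank_eq.symm).1 hT
  obtain ⟨r, hr⟩ := hsurj ((polynomialInner hmoments (Polynomial.X ^ k)).domRestrict V)
  have hdeg : (r : Polynomial ℝ).degree < k := Polynomial.mem_degreeLT.1 r.2
  refine ⟨Polynomial.X ^ k - (r : Polynomial ℝ), Polynomial.monic_X_pow_sub (by simpa using hdeg), ?_, ?_⟩
  · refine Polynomial.natDegree_eq_of_degree_eq_some ?_
    rw [Polynomial.degree_sub_eq_left_of_degree_lt (by simpa using hdeg), Polynomial.degree_X_pow]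
  · intro q hq
    have h := LinearMap.congr_fun hr ⟨q, Polynomial.mem_degreeLT.2 hq⟩
    have h' : polynomialInner hmoments r q = polynomialInner hmoments (Polynomial.X ^ k) q := h
    rw [mul_comm]
    change polynomialInner hmoments (Polynomial.X ^ k - (r : Polynomial ℝ)) q = 0
    rw [map_sub, LinearMap.sub_apply, h', sub_self]

/-- A monic polynomial `q` of degree `k` has the same inner product with the degree `k` monic
orthogonal polynomial as that polynomial itself. -/
lemma integral_monic_mul_orthogonal (hmoments : ∀ k : ℕ, Integrable (fun x : ℝ => x ^ k) μ)
    {k : ℕ} {p q : Polynomial ℝ} (hp : p.Monic) (hpk : p.natDegree = k)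
    (horth : ∀ q : Polynomial ℝ, q.degree < k → ∫ x, (q * p).eval x ∂μ = 0)
    (hq : q.Monic) (hqk : q.natDegree = k) :
    ∫ x, (q * p).eval x ∂μ = ∫ x, (p * p).eval x ∂μ := by
  have hdp : p.degree = k := by rw [Polynomial.degree_eq_natDegree hp.ne_zero, hpk]
  have hdq : q.degree = k := by rw [Polynomial.degree_eq_natDegree hq.ne_zero, hqk]
  have h0 := horth (q - p) <| hdq ▸ Polynomial.degree_sub_lt_left (hdq.trans hdp.symm) hq.ne_zero
    (hq.leadingCoeff.trans hp.leadingCoeff.symm)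
  have h1 : polynomialInner hmoments (q - p) p = 0 := h0
  rw [map_sub, LinearMap.sub_apply, sub_eq_zero] at h1
  exact h1

end OneVariable

section ManyVariables

variable {n : ℕ} {μ : Measure ℝ}

/-- The polynomial `∏ i, q i (x i)` in several variables. -/
noncomputable def tensorPolynomial (q : Fin n → Polynomial ℝ) : MvPolynomial (Fin n) ℝ :=
  ∏ i, Polynomial.aeval (MvPolynomial.X i) (q i)

lemma eval_tensorPolynomial (q : Fin n → Polynomial ℝ) (x : Fin n → ℝ) :
    MvPolynomial.eval x (tensorPolynomial q) = ∏ i, (q i).eval (x i) := by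
  simp only [tensorPolynomial, map_prod]
  refine Finset.prod_congr rfl fun i _ => ?_
  rw [← MvPolynomial.coe_aeval_eq_eval, RingHom.coe_coe, ← Polynomial.aeval_algHom_apply]
  simp [Polynomial.aeval_def, Polynomial.eval₂_eq_eval_map]

lemma tensorPolynomial_X_pow (m : Fin n →₀ ℕ) :
    tensorPolynomial (fun i => Polynomial.X ^ m i) = MvPolynomial.monomial m 1 := by
  simp [tensorPolynomial, MvPolynomial.monomial_eq, Finsupp.prod_fintype]

lemma tensorPolynomial_mul (q r : Fin n → Polynomial ℝ) :
    tensorPolynomial q * tensorPolynomial r = tensorPolynomial (fun i => q i * r i) := by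
  simp [tensorPolynomial, Finset.prod_mul_distrib]

variable [IsProbabilityMeasure μ]

lemma integrable_mvPolynomial_eval (hmoments : ∀ k : ℕ, Integrable (fun x : ℝ => x ^ k) μ)
    (f : MvPolynomial (Fin n) ℝ) :
    Integrable (fun x => MvPolynomial.eval x f) (Measure.pi fun _ : Fin n => μ) := by
  simp_rw [MvPolynomial.eval_eq']
  exact integrable_finsetSum _ fun m _ =>
    (Integrable.fintype_prod (f := fun i x => x ^ m i) fun i => hmoments (m i)).const_mul _

/-- Integration against a product measure, as a linear functional on polynomials. -/
noncomputable def mvPolynomialIntegral (n : ℕ)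
    (hmoments : ∀ k : ℕ, Integrable (fun x : ℝ => x ^ k) μ) :
    MvPolynomial (Fin n) ℝ →ₗ[ℝ] ℝ where
  toFun f := ∫ x, MvPolynomial.eval x f ∂(Measure.pi fun _ : Fin n => μ)
  map_add' f g := by
    simp only [map_add]
    exact integral_add (integrable_mvPolynomial_eval hmoments _)
      (integrable_mvPolynomial_eval hmoments _)
  map_smul' c f := by
    simp only [MvPolynomial.smul_eval, RingHom.id_apply, smul_eq_mul]
    exact integral_const_mul _ _

lemma mvPolynomialIntegral_tensor (hmoments : ∀ k : ℕ, Integrable (fun x : ℝ => x ^ k) μ)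
    (q : Fin n → Polynomial ℝ) :
    mvPolynomialIntegral n hmoments (tensorPolynomial q) = ∏ i, ∫ x, (q i).eval x ∂μ := by
  change ∫ x, MvPolynomial.eval x (tensorPolynomial q) ∂(Measure.pi fun _ : Fin n => μ) = _
  simp_rw [eval_tensorPolynomial]
  exact integral_fintype_prod_eq_prod (μ := fun _ => μ) (fun i x => (q i).eval x)

/-- Tensor products of monic polynomials of multidegree `J` pair with the tensor product of
orthogonal polynomials of multidegree `I` diagonally, provided `|J| ≤ |I|`. -/
lemma mvPolynomialIntegral_tensor_mul_orthogonal
    (hmoments : ∀ k : ℕ, Integrable (fun x : ℝ => x ^ k) μ) {p : ℕ → Polynomial ℝ}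
    (hp : ∀ k, (p k).Monic) (hpk : ∀ k, (p k).natDegree = k)
    (horth : ∀ k : ℕ, ∀ q : Polynomial ℝ, q.degree < k → ∫ x, (q * p k).eval x ∂μ = 0)
    {I J : Fin n →₀ ℕ} (hIJ : ∑ i, J i ≤ ∑ i, I i) {q : Fin n → Polynomial ℝ}
    (hq : ∀ i, (q i).Monic) (hqJ : ∀ i, (q i).natDegree = J i) :
    mvPolynomialIntegral n hmoments (tensorPolynomial q * tensorPolynomial fun i => p (I i)) =
      if J = I then ∏ i, ∫ x, (p (I i) * p (I i)).eval x ∂μ else 0 := by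
  rw [tensorPolynomial_mul, mvPolynomialIntegral_tensor]
  split_ifs with h
  · subst h
    exact Finset.prod_congr rfl fun i _ =>
      integral_monic_mul_orthogonal hmoments (hp _) (hpk _) (horth _) (hq i) (hqJ i)
  · obtain ⟨i, hi⟩ : ∃ i, J i < I i := by
      by_contra! hle
      refine h (Finsupp.ext fun i => ?_)
      have hsum := le_antisymm hIJ (Finset.sum_le_sum fun i _ => hle i)
      exact ((Finset.sum_eq_sum_iff_of_le fun i _ => hle i).1 hsum.symm i (Finset.mem_univ i)).symm
    refine Finset.prod_eq_zero (Finset.mem_univ i) (horth _ _ ?_)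
    rw [Polynomial.degree_eq_natDegree (hq i).ne_zero, hqJ]
    exact_mod_cast hi

/-- Pairing a polynomial of degree at most `d` with the tensor product of orthogonal polynomials
of a multidegree of size `d` extracts the corresponding coefficient. -/
lemma mvPolynomialIntegral_mul_orthogonal
    (hmoments : ∀ k : ℕ, Integrable (fun x : ℝ => x ^ k) μ) {p : ℕ → Polynomial ℝ}
    (hp : ∀ k, (p k).Monic) (hpk : ∀ k, (p k).natDegree = k)
    (horth : ∀ k : ℕ, ∀ q : Polynomial ℝ, q.degree < k → ∫ x, (q * p k).eval x ∂μ = 0)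
    {d : ℕ} {f : MvPolynomial (Fin n) ℝ} (hf : f.totalDegree ≤ d)
    {I : Fin n →₀ ℕ} (hI : ∑ i, I i = d) :
    mvPolynomialIntegral n hmoments (f * tensorPolynomial fun i => p (I i)) =
      f.coeff I * ∏ i, ∫ x, (p (I i) * p (I i)).eval x ∂μ := by
  conv_lhs => rw [f.as_sum, Finset.sum_mul, map_sum]
  have hterm : ∀ J ∈ f.support, mvPolynomialIntegral n hmoments
      (MvPolynomial.monomial J (f.coeff J) * tensorPolynomial fun i => p (I i)) =
      if J = I then f.coeff I * ∏ i, ∫ x, (p (I i) * p (I i)).eval x ∂μ else 0 := by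
    intro J hJ
    have hJd : ∑ i, J i ≤ ∑ i, I i := by
      have := (MvPolynomial.le_totalDegree hJ).trans hf
      rwa [Finsupp.sum_fintype _ _ fun _ => rfl, ← hI] at this
    have hmonomial : MvPolynomial.monomial J (f.coeff J) =
        f.coeff J • MvPolynomial.monomial J 1 := by
      rw [MvPolynomial.smul_monomial, smul_eq_mul, mul_one]
    rw [hmonomial, ← tensorPolynomial_X_pow, smul_mul_assoc, map_smul,
      mvPolynomialIntegral_tensor_mul_orthogonal hmoments hp hpk horth hJd
        (fun i => Polynomial.monic_X_pow _) (fun i => Polynomial.natDegree_X_pow _)]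
    split_ifs with h
    · rw [h, smul_eq_mul]
    · simp
  rw [Finset.sum_congr rfl hterm, Finset.sum_ite_eq']
  split_ifs with h
  · rfl
  · rw [MvPolynomial.notMem_support_iff.1 h, zero_mul]

/-- Bessel's inequality for the orthogonal polynomials of top degree. -/
lemma sum_coeff_sq_mul_le_variance
    (hmoments : ∀ k : ℕ, Integrable (fun x : ℝ => x ^ k) μ) {p : ℕ → Polynomial ℝ}
    (hp : ∀ k, (p k).Monic) (hpk : ∀ k, (p k).natDegree = k)
    (horth : ∀ k : ℕ, ∀ q : Polynomial ℝ, q.degree < k → ∫ x, (q * p k).eval x ∂μ = 0)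
    {d : ℕ} (hd : 0 < d) {f : MvPolynomial (Fin n) ℝ} (hf : f.totalDegree ≤ d) :
    ∑ I ∈ f.support.filter (fun m => (∑ i, m i) = d),
        f.coeff I ^ 2 * ∏ i, ∫ x, (p (I i) * p (I i)).eval x ∂μ ≤
      (∫ x, (MvPolynomial.eval x f) ^ 2 ∂(Measure.pi fun _ : Fin n => μ)) -
          (∫ x, MvPolynomial.eval x f ∂(Measure.pi fun _ : Fin n => μ)) ^ 2 := by
  set E := mvPolynomialIntegral n hmoments
  set S := f.support.filter (fun m => (∑ i, m i) = d)
  set P : (Fin n →₀ ℕ) → MvPolynomial (Fin n) ℝ := fun I => tensorPolynomial fun i => p (I i)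
  set N : (Fin n →₀ ℕ) → ℝ := fun I => ∏ i, ∫ x, (p (I i) * p (I i)).eval x ∂μ
  set A := ∑ I ∈ S, f.coeff I ^ 2 * N I with hA
  set g := ∑ I ∈ S, f.coeff I • P I with hg
  have hE1 : E 1 = 1 := by
    change ∫ x, MvPolynomial.eval x 1 ∂(Measure.pi fun _ : Fin n => μ) = 1
    simp
  have hsq : (∫ x, (MvPolynomial.eval x f) ^ 2 ∂(Measure.pi fun _ : Fin n => μ)) = E (f * f) := by
    change _ = ∫ x, MvPolynomial.eval x (f * f) ∂(Measure.pi fun _ : Fin n => μ)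
    simp [pow_two]
  have hmean : (∫ x, MvPolynomial.eval x f ∂(Measure.pi fun _ : Fin n => μ)) = E f := rfl
  have hmem : ∀ I ∈ S, ∑ i, I i = d := fun I hI => (Finset.mem_filter.1 hI).2
  have hfg : E (f * g) = A := by
    rw [hg, Finset.mul_sum, map_sum]
    refine Finset.sum_congr rfl fun I hI => ?_
    rw [mul_smul_comm, map_smul,
      mvPolynomialIntegral_mul_orthogonal hmoments hp hpk horth hf (hmem I hI), smul_eq_mul]
    ring
  have hEg : E g = 0 := by
    rw [hg, map_sum]
    refine Finset.sum_eq_zero fun I hI => ?_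
    have h1 := mvPolynomialIntegral_mul_orthogonal hmoments hp hpk horth
      (f := 1) (d := d) (by simp) (hmem I hI)
    have hI0 : (0 : Fin n →₀ ℕ) ≠ I := by
      rintro rfl
      have := hmem _ hI
      simp at this
      omega
    rw [one_mul, MvPolynomial.coeff_one, if_neg hI0, zero_mul] at h1
    rw [map_smul, h1, smul_zero]
  have hgg : E (g * g) = A := by
    rw [hA]
    conv_lhs => rw [hg, Finset.mul_sum, map_sum]
    refine Finset.sum_congr rfl fun I hI => ?_
    rw [mul_smul_comm, map_smul, Finset.sum_mul, map_sum]
    have hterm : ∀ J ∈ S, E (f.coeff J • P J * P I) = if J = I then f.coeff I * N I else 0 := by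
      intro J hJ
      rw [smul_mul_assoc, map_smul, mvPolynomialIntegral_tensor_mul_orthogonal hmoments hp hpk
        horth ((hmem J hJ).trans (hmem I hI).symm).le (fun i => hp _) (fun i => hpk _)]
      split_ifs with h
      · rw [h, smul_eq_mul]
      · simp
    rw [Finset.sum_congr rfl hterm, Finset.sum_ite_eq', if_pos hI, smul_eq_mul]
    ring
  have hpos : 0 ≤ E ((f - E f • 1 - g) * (f - E f • 1 - g)) := by
    change 0 ≤ ∫ x, MvPolynomial.eval x _ ∂(Measure.pi fun _ : Fin n => μ)
    refine integral_nonneg fun x => ?_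
    simp only [map_mul]
    exact mul_self_nonneg _
  have hexp : (f - E f • 1 - g) * (f - E f • 1 - g) =
      f * f + (E f * E f) • 1 + g * g - (2 * E f) • f - (2 : ℝ) • (f * g) + (2 * E f) • g := by
    simp only [MvPolynomial.smul_eq_C_mul, map_mul, map_ofNat]
    ring
  rw [hexp] at hpos
  simp only [map_add, map_sub, map_smul, smul_eq_mul, hE1, hfg, hgg, hEg] at hpos
  rw [hsq, hmean]
  linarith

end ManyVariables

/-- A product of terms of a sequence with `N 0 = 1` and total index `d` is bounded below by
`c ^ d` whenever `c ∈ (0, 1]` bounds the first `d` terms from below. -/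
lemma pow_le_prod_of_sum_eq {ι : Type*} [Fintype ι] {N : ℕ → ℝ} (hN0 : N 0 = 1) {c : ℝ} {d : ℕ}
    (hc0 : 0 < c) (hc1 : c ≤ 1) (hc : ∀ k ≤ d, c ≤ N k) {I : ι → ℕ} (hI : ∑ i, I i = d) :
    c ^ d ≤ ∏ i, N (I i) := by
  rw [← hI, ← Finset.prod_pow_eq_pow_sum]
  refine Finset.prod_le_prod (fun i _ => by positivity) fun i _ => ?_
  rcases Nat.eq_zero_or_pos (I i) with h | h
  · simp [h, hN0]
  · exact (pow_le_of_le_one hc0.le hc1 h.ne').trans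
      (hc _ (hI ▸ Finset.single_le_sum (fun _ _ => Nat.zero_le _) (Finset.mem_univ i)))

lemma exists_pos_lower_bound {N : ℕ → ℝ} (hN : ∀ k, 0 < N k) (d : ℕ) :
    ∃ c, 0 < c ∧ c ≤ 1 ∧ ∀ k ≤ d, c ≤ N k := by
  obtain ⟨m, -, hm⟩ := (Finset.range (d + 1)).exists_min_image N ⟨0, by simp⟩
  exact ⟨min 1 (N m), lt_min one_pos (hN m), min_le_left _ _, fun k hk =>
    (min_le_right _ _).trans (hm k (by simpa [Nat.lt_succ_iff] using hk))⟩

/-- product measures, dimension-free variance bound. -/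
theorem stmt0 (μ : Measure ℝ) [IsProbabilityMeasure μ]
    (hcentered : ∫ x, x ∂μ = 0)
    (hmoments : ∀ k : ℕ, Integrable (fun x : ℝ => x ^ k) μ)
    (hsupp : {x : ℝ | ∀ U ∈ nhds x, μ U ≠ 0}.Infinite)
    (d : ℕ) (hd : 0 < d) :
    ∃ C > 0, ∀ (n : ℕ) (f : MvPolynomial (Fin n) ℝ), f.totalDegree ≤ d →
      (∫ x, (MvPolynomial.eval x f) ^ 2 ∂(Measure.pi fun _ : Fin n => μ)) -
          (∫ x, MvPolynomial.eval x f ∂(Measure.pi fun _ : Fin n => μ)) ^ 2 ≥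
        C * coeffd d f ^ 2 := by
  choose p hp hpk horth using exists_monic_orthogonal hmoments hsupp
  set N : ℕ → ℝ := fun k => ∫ x, (p k * p k).eval x ∂μ
  have hN0 : N 0 = 1 := by
    have h : p 0 = 1 := (hp 0).natDegree_eq_zero.1 (hpk 0)
    simp [N, h]
  obtain ⟨c, hc0, hc1, hc⟩ := exists_pos_lower_bound (N := N)
    (fun k => integral_polynomial_sq_pos hmoments hsupp (hp k).ne_zero) d
  refine ⟨c ^ d, by positivity, fun n f hf => ?_⟩
  refine le_trans ?_ (sum_coeff_sq_mul_le_variance hmoments hp hpk horth hd hf)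
  rw [coeffd, Real.sq_sqrt (Finset.sum_nonneg fun _ _ => sq_nonneg _), Finset.mul_sum]
  refine Finset.sum_le_sum fun I hI => ?_
  rw [mul_comm]
  exact mul_le_mul_of_nonneg_left
    (pow_le_prod_of_sum_eq hN0 hc0 hc1 hc (Finset.mem_filter.1 hI).2) (sq_nonneg _)
end

section
/- Fix d ∈ ℕ. There exists a constant C_d > 0, depending only on d, such that for every p ≥ 1, every n ∈ ℕ, and every homogeneous polynomial f : ℝⁿ → ℝ of degree d, if μ is the uniform probability measure on the isotropic L_p ball B̃_{p,n}, then ∫ f² dμ ≥ C_d · coeff_d(f)². -/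
open MeasureTheory

/-- The `L_p` ball of radius `r` in `ℝⁿ`. -/
def pball (p : ℝ) (n : ℕ) (r : ℝ) : Set (Fin n → ℝ) :=
  {x | (∑ i, |x i| ^ p) ^ (1 / p) ≤ r}

/-- The uniform (normalized Lebesgue) probability measure on a set `s ⊆ ℝⁿ`. -/
noncomputable def unif {n : ℕ} (s : Set (Fin n → ℝ)) : Measure (Fin n → ℝ) :=
  (volume s)⁻¹ • volume.restrict s


/-- The increments of `log Γ` over steps of length at most `2` vary by a bounded amount when the
base point is moved by a bounded factor. -/
theorem logGamma_add_sub_le {a b h c : ℝ} (ha : 1 ≤ a) (hb : 0 < b) (hh : 0 < h) (hh2 : h ≤ 2)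
    (hc : 1 ≤ c) (hbc : b + 1 ≤ a * c) :
    Real.log (Real.Gamma (b + h)) - Real.log (Real.Gamma b) ≤
      Real.log (Real.Gamma (a + h)) - Real.log (Real.Gamma a) + (2 * Real.log c + Real.log 3) := by
  have ha0 : 0 < a := by linarith
  have add_one : ∀ x : ℝ, 0 < x →
      Real.log (Real.Gamma (x + 1)) = Real.log x + Real.log (Real.Gamma x) := fun x hx => by
    rw [Real.Gamma_add_one hx.ne', Real.log_mul hx.ne' (Real.Gamma_pos_of_pos hx).ne']
  have conv := Real.convexOn_log_Gamma.2
  have upper : Real.log (Real.Gamma (b + h)) ≤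
      (1 - h / 2) * Real.log (Real.Gamma b) + h / 2 * Real.log (Real.Gamma (b + 2)) := by
    have := @conv b hb (b + 2) (Set.mem_Ioi.2 (by linarith)) (1 - h / 2) (h / 2)
      (by linarith) (by linarith) (by ring)
    simp only [smul_eq_mul, Function.comp] at this
    rwa [show (1 - h / 2) * b + h / 2 * (b + 2) = b + h by ring] at this
  have lower : (1 + h) * Real.log (Real.Gamma (a + 1)) ≤
      h * Real.log (Real.Gamma a) + Real.log (Real.Gamma (a + h + 1)) := by
    have := @conv a ha0 (a + h + 1) (Set.mem_Ioi.2 (by linarith)) (h / (1 + h)) (1 / (1 + h))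
      (by positivity) (by positivity) (by field_simp; ring)
    simp only [smul_eq_mul, Function.comp] at this
    rw [show h / (1 + h) * a + 1 / (1 + h) * (a + h + 1) = a + 1 by field_simp; ring] at this
    have h' := mul_le_mul_of_nonneg_left this (by linarith : 0 ≤ 1 + h)
    refine h'.trans_eq ?_
    field_simp
  have e2 : Real.log (Real.Gamma (b + 2)) =
      Real.log (b + 1) + Real.log b + Real.log (Real.Gamma b) := by
    rw [show b + 2 = b + 1 + 1 by ring, add_one _ (by linarith), add_one _ hb]; ring
  rw [e2] at upper
  rw [add_one _ ha0, add_one _ (by linarith : 0 < a + h)] at lower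
  have l1 : Real.log b ≤ Real.log (b + 1) := Real.log_le_log hb (by linarith)
  have l2 : Real.log (b + 1) ≤ Real.log a + Real.log c := by
    rw [← Real.log_mul ha0.ne' (by linarith)]
    exact Real.log_le_log (by linarith) hbc
  have l3 : Real.log (a + h) ≤ Real.log a + Real.log 3 := by
    rw [← Real.log_mul ha0.ne' (by norm_num)]
    exact Real.log_le_log (by linarith) (by linarith)
  have l4 : 0 ≤ Real.log c := Real.log_nonneg hc
  nlinarith [mul_le_mul_of_nonneg_left l1 hh.le, mul_le_mul_of_nonneg_left l2 hh.le,
    mul_le_mul_of_nonneg_right hh2 l4]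

/-- A reverse log-convexity inequality for the Gamma function, with a constant that does not depend
on the base point `a` or the step `h`. -/
theorem exists_Gamma_add_nat_mul_le (d : ℕ) : ∃ K > 0, ∀ a h : ℝ, 1 ≤ a → 0 < h → h ≤ 2 →
    Real.Gamma (a + d * h) / Real.Gamma a ≤ K * (Real.Gamma (a + h) / Real.Gamma a) ^ d := by
  suffices H : ∃ k : ℝ, ∀ a h : ℝ, 1 ≤ a → 0 < h → h ≤ 2 →
      Real.log (Real.Gamma (a + d * h)) - Real.log (Real.Gamma a) ≤
        k + d * (Real.log (Real.Gamma (a + h)) - Real.log (Real.Gamma a)) by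
    obtain ⟨k, hk⟩ := H
    refine ⟨Real.exp k, Real.exp_pos k, fun a h ha hh hh2 => ?_⟩
    have g0 : 0 < Real.Gamma a := Real.Gamma_pos_of_pos (by linarith)
    have g1 : 0 < Real.Gamma (a + h) := Real.Gamma_pos_of_pos (by linarith)
    have g2 : 0 < Real.Gamma (a + d * h) := Real.Gamma_pos_of_pos (by positivity)
    rw [← Real.log_le_log_iff (by positivity) (by positivity),
      Real.log_mul (Real.exp_pos k).ne' (by positivity), Real.log_exp, Real.log_pow,
      Real.log_div g2.ne' g0.ne', Real.log_div g1.ne' g0.ne']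
    exact hk a h ha hh hh2
  induction d with
  | zero => exact ⟨0, fun a h _ _ _ => by simp⟩
  | succ d ih =>
    obtain ⟨k, hk⟩ := ih
    refine ⟨k + (2 * Real.log (2 * d + 2) + Real.log 3), fun a h ha hh hh2 => ?_⟩
    have hd : (0 : ℝ) ≤ d := d.cast_nonneg
    have hdh : d * h ≤ d * 2 := mul_le_mul_of_nonneg_left hh2 hd
    have := logGamma_add_sub_le (b := a + d * h) (c := 2 * d + 2) ha (by positivity) hh hh2
      (by linarith) (by nlinarith)
    have h1 := hk a h ha hh hh2
    rw [show a + d * h + h = a + ((d + 1 : ℕ) : ℝ) * h by push_cast; ring] at this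
    push_cast at this ⊢
    linarith

open Polynomial in
/-- Monic orthogonal polynomials of a positive definite linear functional. -/
theorem exists_monic_orthogonal_s2 (L : ℝ[X] →ₗ[ℝ] ℝ) (hL : ∀ q ≠ 0, 0 < L (q * q)) (k : ℕ) :
    ∃ P : ℝ[X], P.Monic ∧ P.natDegree = k ∧ ∀ q : ℝ[X], q.degree < k → L (q * P) = 0 := by
  let T : degreeLT ℝ k →ₗ[ℝ] Module.Dual ℝ (degreeLT ℝ k) :=
    ((LinearMap.mul ℝ ℝ[X]).compr₂ L).domRestrict₁₂ (degreeLT ℝ k) (degreeLT ℝ k)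
  have hT : ∀ r q, T r q = L (r.1 * q.1) := fun r q => rfl
  have : FiniteDimensional ℝ (degreeLT ℝ k) := (degreeLTEquiv ℝ k).symm.finiteDimensional
  have inj : Function.Injective T := by
    rw [injective_iff_map_eq_zero]
    intro r hr
    by_contra hne
    have := hL r.1 (fun h => hne (Subtype.ext h))
    rw [← hT, hr] at this
    simp at this
  have surj : Function.Surjective T :=
    (LinearMap.injective_iff_surjective_of_finrank_eq_finrank
      (Subspace.dual_finrank_eq).symm).1 inj
  obtain ⟨r, hr⟩ := surj ((L ∘ₗ LinearMap.mulLeft ℝ (X ^ k)) ∘ₗ (degreeLT ℝ k).subtype)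
  have hrd : r.1.degree < k := mem_degreeLT.1 r.2
  refine ⟨X ^ k - r.1, monic_X_pow_sub hrd, ?_, fun q hq => ?_⟩
  · refine natDegree_eq_of_degree_eq_some ?_
    rw [degree_sub_eq_left_of_degree_lt (by simpa using hrd), degree_X_pow]
  · have := congrArg (fun F => F ⟨q, mem_degreeLT.2 hq⟩) hr
    simp only [hT, LinearMap.comp_apply, Submodule.subtype_apply, LinearMap.mulLeft_apply] at this
    rw [mul_comm, sub_mul, map_sub, this, sub_self]

open Polynomial in
/-- A positive definite functional is bounded below on squares of monic polynomials of a given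
degree. -/
theorem exists_le_apply_sq_of_monic (L : ℝ[X] →ₗ[ℝ] ℝ) (hL : ∀ q ≠ 0, 0 < L (q * q)) (k : ℕ) :
    ∃ m > 0, ∀ q : ℝ[X], q.Monic → q.natDegree = k → m ≤ L (q * q) := by
  obtain ⟨P, hP, hPk, horth⟩ := exists_monic_orthogonal_s2 L hL k
  refine ⟨L (P * P), hL P hP.ne_zero, fun q hq hqk => ?_⟩
  have hlt : (q - P).degree < k := by
    have := degree_sub_lt_left (p := q) (q := P)
      (by rw [degree_eq_natDegree hq.ne_zero, degree_eq_natDegree hP.ne_zero, hqk, hPk])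
      hq.ne_zero (by rw [hq.leadingCoeff, hP.leadingCoeff])
    rwa [degree_eq_natDegree hq.ne_zero, hqk] at this
  have h0 := horth _ hlt
  have h1 : 0 ≤ L ((q - P) * (q - P)) := by
    by_cases h : q - P = 0
    · simp [h]
    · exact (hL _ h).le
  have e : q * q = P * P + (q - P) * (q - P) + (q - P) * P + (q - P) * P := by ring
  rw [e]
  simp only [map_add, h0]
  linarith

open Polynomial in
/-- Integration of polynomials against a weight all of whose moments are finite. -/
noncomputable def momentFunctional (w : ℝ → ℝ)
    (hw : ∀ q : ℝ[X], Integrable (fun y => q.eval y * w y)) : ℝ[X] →ₗ[ℝ] ℝ where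
  toFun q := ∫ y, q.eval y * w y
  map_add' q r := by
    simp only [eval_add, add_mul]
    exact integral_add (hw q) (hw r)
  map_smul' c q := by
    simp only [eval_smul, smul_eq_mul, mul_assoc, RingHom.id_apply]
    exact integral_const_mul _ _

open Polynomial in
theorem momentFunctional_mul_self_pos {w : ℝ → ℝ}
    (hw : ∀ q : ℝ[X], Integrable (fun y => q.eval y * w y)) (h0 : ∀ y, 0 ≤ w y)
    (h1 : ∀ y ∈ Set.Ioo (-1 : ℝ) 1, 0 < w y) (q : ℝ[X]) (hq : q ≠ 0) :
    0 < momentFunctional w hw (q * q) := by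
  change 0 < ∫ y, (q * q).eval y * w y
  rw [integral_pos_iff_support_of_nonneg _ (hw _)]
  · have hsub : Set.Ioo (-1 : ℝ) 1 \ {y | q.IsRoot y} ⊆
        Function.support (fun y => (q * q).eval y * w y) := fun y hy => by
      have : q.eval y ≠ 0 := hy.2
      simp only [Function.mem_support, eval_mul]
      exact mul_ne_zero (mul_ne_zero this this) (h1 y hy.1).ne'
    refine lt_of_lt_of_le ?_ (measure_mono hsub)
    rw [measure_sdiff_null (Set.Finite.measure_zero (finite_setOfPred_isRoot hq) _)]
    simp
  · intro y
    simp only [eval_mul]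
    exact mul_nonneg (mul_self_nonneg _) (h0 y)

open Polynomial in
theorem integrable_prod_eval_mul_prod {n : ℕ} {w : ℝ → ℝ}
    (hw : ∀ q : ℝ[X], Integrable (fun y => q.eval y * w y)) (Q : Fin n → ℝ[X]) :
    Integrable (fun x : Fin n → ℝ => (∏ i, (Q i).eval (x i)) * ∏ i, w (x i)) := by
  simp only [← Finset.prod_mul_distrib]
  exact Integrable.fintype_prod (f := fun i y => (Q i).eval y * w y) fun i => hw (Q i)

open Polynomial in
theorem integral_prod_eval_mul_prod {n : ℕ} {w : ℝ → ℝ}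
    (hw : ∀ q : ℝ[X], Integrable (fun y => q.eval y * w y)) (Q : Fin n → ℝ[X]) :
    ∫ x : Fin n → ℝ, (∏ i, (Q i).eval (x i)) * ∏ i, w (x i) =
      ∏ i, momentFunctional w hw (Q i) := by
  simp only [← Finset.prod_mul_distrib]
  exact integral_fintype_prod_volume_eq_prod fun i y => (Q i).eval y * w y

open Polynomial in
theorem integrable_mvPolynomial_eval_mul_prod {n : ℕ} {w : ℝ → ℝ}
    (hw : ∀ q : ℝ[X], Integrable (fun y => q.eval y * w y)) (f : MvPolynomial (Fin n) ℝ) :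
    Integrable (fun x : Fin n → ℝ => MvPolynomial.eval x f * ∏ i, w (x i)) := by
  simp only [MvPolynomial.eval_eq', Finset.sum_mul, mul_assoc]
  refine integrable_finsetSum _ fun I _ => Integrable.const_mul ?_ _
  simpa using integrable_prod_eval_mul_prod hw fun i => (X : ℝ[X]) ^ I i

open Polynomial in
/-- Second-moment lower bound for homogeneous polynomials under a product weight, in terms of the
one-dimensional norms of monic polynomials. -/
theorem le_integral_sq_mul_prod {n d : ℕ} {w : ℝ → ℝ}
    (hw : ∀ q : ℝ[X], Integrable (fun y => q.eval y * w y)) (h0 : ∀ y, 0 ≤ w y)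
    (h1 : ∀ y ∈ Set.Ioo (-1 : ℝ) 1, 0 < w y) {κ : ℝ} (hκ : 0 < κ) (hκ1 : κ ≤ 1)
    (hmin : ∀ k ≤ d, ∀ q : ℝ[X], q.Monic → q.natDegree = k →
      κ * ∫ y, w y ≤ momentFunctional w hw (q * q))
    (f : MvPolynomial (Fin n) ℝ) (hf : f.IsHomogeneous d) :
    κ ^ d * (∫ y, w y) ^ n * ∑ I ∈ f.support, f.coeff I ^ 2 ≤
      ∫ x : Fin n → ℝ, MvPolynomial.eval x f ^ 2 * ∏ i, w (x i) := by
  have hL := momentFunctional_mul_self_pos hw h0 h1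
  set L := momentFunctional w hw with hLdef
  choose P hPm hPd hPo using exists_monic_orthogonal_s2 L hL
  have hZ : 0 ≤ ∫ y, w y := integral_nonneg h0
  have hPdeg : ∀ k, (P k).degree = k := fun k => by
    rw [degree_eq_natDegree (hPm k).ne_zero, hPd]
  have hXP : ∀ k, L (X ^ k * P k) = L (P k * P k) := fun k => by
    have hlt : (X ^ k - P k).degree < (k : WithBot ℕ) := by
      have := degree_sub_lt_left (p := X ^ k) (q := P k) (by rw [hPdeg, degree_X_pow])
        (monic_X_pow k).ne_zero (by rw [(monic_X_pow k).leadingCoeff, (hPm k).leadingCoeff])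
      rwa [degree_X_pow] at this
    have := hPo k _ hlt
    rw [sub_mul, map_sub] at this
    linarith
  have hsum : ∀ I ∈ f.support, ∑ i, I i = d := fun I hI => by
    rw [← hf (MvPolynomial.mem_support_iff.1 hI), ← Finsupp.degree_eq_sum]
    exact DFunLike.congr_fun Finsupp.degree_eq_weight_one I
  have hlt : ∀ I ∈ f.support, ∀ J ∈ f.support, I ≠ J → ∃ i, I i < J i := by
    intro I hI J hJ hne
    by_contra! hle
    refine hne (Finsupp.ext fun i => ?_)
    exact ((Finset.sum_eq_sum_iff_of_le (fun i _ => hle i)).1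
      ((hsum J hJ).trans (hsum I hI).symm) i (Finset.mem_univ i)).symm
  have hdiag : ∀ I ∈ f.support, κ ^ d * (∫ y, w y) ^ n ≤ ∏ i, L (P (I i) * P (I i)) := by
    intro I hI
    have e : κ ^ d * (∫ y, w y) ^ n = ∏ i : Fin n, (κ ^ I i * ∫ y, w y) := by
      rw [Finset.prod_mul_distrib, Finset.prod_pow_eq_pow_sum, hsum I hI]
      simp
    rw [e]
    refine Finset.prod_le_prod (fun i _ => by positivity) fun i _ => ?_
    rcases Nat.eq_zero_or_pos (I i) with hi | hi
    · have : P 0 = 1 := (hPm 0).natDegree_eq_zero.1 (hPd 0)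
      rw [hi, this, hLdef]
      simp [momentFunctional]
    · have hle : I i ≤ d := by
        rw [← hsum I hI]
        exact Finset.single_le_sum (f := fun i => I i) (fun _ _ => Nat.zero_le _)
          (Finset.mem_univ i)
      refine le_trans (mul_le_mul_of_nonneg_right ?_ hZ) (hmin _ hle _ (hPm _) (hPd _))
      exact pow_le_of_le_one hκ.le hκ1 hi.ne'
  let A : (Fin n →₀ ℕ) → (Fin n → ℝ) → ℝ := fun I x => ∏ i, ((X : ℝ[X]) ^ I i).eval (x i)
  let B : (Fin n →₀ ℕ) → (Fin n → ℝ) → ℝ := fun I x => ∏ i, (P (I i)).eval (x i)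
  let W : (Fin n → ℝ) → ℝ := fun x => ∏ i, w (x i)
  have hAB : ∀ I J x, A I x * B J x * W x =
      (∏ i, ((X : ℝ[X]) ^ I i * P (J i)).eval (x i)) * ∏ i, w (x i) := fun I J x => by
    simp only [A, B, W, ← Finset.prod_mul_distrib, eval_mul]
  have hBB : ∀ I J x, B I x * B J x * W x =
      (∏ i, (P (I i) * P (J i)).eval (x i)) * ∏ i, w (x i) := fun I J x => by
    simp only [B, W, ← Finset.prod_mul_distrib, eval_mul]
  have iAB : ∀ I J, Integrable (fun x => A I x * B J x * W x) := fun I J => by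
    simp only [hAB]; exact integrable_prod_eval_mul_prod hw _
  have iBB : ∀ I J, Integrable (fun x => B I x * B J x * W x) := fun I J => by
    simp only [hBB]; exact integrable_prod_eval_mul_prod hw _
  have key : ∀ I ∈ f.support, ∀ J ∈ f.support,
      ∫ x, (2 * (A I x * B J x * W x) - B I x * B J x * W x) =
        if I = J then ∏ i, L (P (I i) * P (I i)) else 0 := by
    intro I hI J hJ
    rw [integral_sub ((iAB I J).const_mul 2) (iBB I J), integral_const_mul]
    simp only [hAB, hBB]
    rw [integral_prod_eval_mul_prod hw, integral_prod_eval_mul_prod hw]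
    split_ifs with h
    · subst h
      simp only [← hLdef, hXP]
      ring
    · obtain ⟨i, hi⟩ := hlt I hI J hJ h
      rw [Finset.prod_eq_zero (Finset.mem_univ i), Finset.prod_eq_zero (Finset.mem_univ i)]
      · simp
      · exact hPo _ _ (by rw [hPdeg]; exact_mod_cast hi)
      · exact hPo _ _ (by rw [degree_X_pow]; exact_mod_cast hi)
  have heval : ∀ x, MvPolynomial.eval x f = ∑ I ∈ f.support, f.coeff I * A I x := fun x => by
    simp [MvPolynomial.eval_eq', A]
  have hint : ∀ I J, Integrable (fun x => f.coeff I * f.coeff J *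
      (2 * (A I x * B J x * W x) - B I x * B J x * W x)) := fun I J =>
    (((iAB I J).const_mul 2).sub (iBB I J)).const_mul _
  calc κ ^ d * (∫ y, w y) ^ n * ∑ I ∈ f.support, f.coeff I ^ 2
      ≤ ∑ I ∈ f.support, f.coeff I ^ 2 * ∏ i, L (P (I i) * P (I i)) := by
        rw [Finset.mul_sum]
        refine Finset.sum_le_sum fun I hI => ?_
        rw [mul_comm]
        exact mul_le_mul_of_nonneg_left (hdiag I hI) (sq_nonneg _)
    _ = ∑ I ∈ f.support, ∑ J ∈ f.support, ∫ x, f.coeff I * f.coeff J *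
          (2 * (A I x * B J x * W x) - B I x * B J x * W x) := by
        refine Finset.sum_congr rfl fun I hI => ?_
        rw [Finset.sum_congr rfl fun J hJ => by rw [integral_const_mul, key I hI J hJ]]
        simp [hI, sq]
    _ = ∫ x, ∑ I ∈ f.support, ∑ J ∈ f.support, f.coeff I * f.coeff J *
          (2 * (A I x * B J x * W x) - B I x * B J x * W x) := by
        rw [integral_finsetSum _ fun I _ => integrable_finsetSum _ fun J _ => hint I J]
        exact Finset.sum_congr rfl fun I _ => (integral_finsetSum _ fun J _ => hint I J).symm
    _ ≤ ∫ x, MvPolynomial.eval x f ^ 2 * W x := by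
        refine integral_mono
          (integrable_finsetSum _ fun I _ => integrable_finsetSum _ fun J _ => hint I J)
          ((integrable_mvPolynomial_eval_mul_prod hw (f ^ 2)).congr
            (Filter.Eventually.of_forall fun x => by simp only [map_pow, W])) fun x => ?_
        have hW : 0 ≤ W x := Finset.prod_nonneg fun i _ => h0 _
        have e : ∑ I ∈ f.support, ∑ J ∈ f.support, f.coeff I * f.coeff J *
            (2 * (A I x * B J x * W x) - B I x * B J x * W x) =
            (2 * (MvPolynomial.eval x f * ∑ J ∈ f.support, f.coeff J * B J x) -
              (∑ J ∈ f.support, f.coeff J * B J x) * ∑ J ∈ f.support, f.coeff J * B J x)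
              * W x := by
          rw [heval, Finset.sum_mul_sum, Finset.sum_mul_sum, Finset.mul_sum,
            ← Finset.sum_sub_distrib, Finset.sum_mul]
          refine Finset.sum_congr rfl fun I _ => ?_
          rw [Finset.mul_sum, ← Finset.sum_sub_distrib, Finset.sum_mul]
          exact Finset.sum_congr rfl fun J _ => by ring
        simp only [e]
        refine mul_le_mul_of_nonneg_right ?_ hW
        nlinarith [sq_nonneg (MvPolynomial.eval x f - ∑ J ∈ f.support, f.coeff J * B J x)]

theorem pball_eq {p : ℝ} (hp : 1 ≤ p) (n : ℕ) {r : ℝ} (hr : 0 ≤ r) :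
    pball p n r = {x | ∑ i, |x i| ^ p ≤ r ^ p} := by
  have hp0 : 0 < p := by linarith
  ext x
  have hN : 0 ≤ ∑ i, |x i| ^ p := Finset.sum_nonneg fun i _ => by positivity
  simp only [pball, Set.mem_ofPred_eq, one_div]
  exact Real.rpow_inv_le_iff_of_pos hN hr hp0

theorem measurableSet_pball (p : ℝ) (n : ℕ) (r : ℝ) :
    MeasurableSet (pball p n r) := by
  have : Measurable fun x : Fin n → ℝ => (∑ i, |x i| ^ p) ^ (1 / p) := by fun_prop
  exact this measurableSet_Iic

theorem smul_mem_pball_iff {p : ℝ} (hp : 1 ≤ p) {n : ℕ} {t : ℝ} (ht : 0 < t) (x : Fin n → ℝ) :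
    t • x ∈ pball p n t ↔ x ∈ pball p n 1 := by
  rw [pball_eq hp n ht.le, pball_eq hp n zero_le_one]
  simp only [Set.mem_ofPred_eq, Pi.smul_apply, smul_eq_mul, abs_mul, abs_of_pos ht,
    Real.mul_rpow ht.le (abs_nonneg _), ← Finset.mul_sum, Real.one_rpow]
  exact mul_le_iff_le_one_right (by positivity)

/-- Scaling of the integral of a homogeneous function over `L_p` balls. -/
theorem setLIntegral_pball_of_homogeneous {p : ℝ} (hp : 1 ≤ p) {n s : ℕ}
    {F : (Fin n → ℝ) → ENNReal} (hF : Measurable F)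
    (hFs : ∀ t : ℝ, 0 < t → ∀ x, F (t • x) = ENNReal.ofReal (t ^ s) * F x) {t : ℝ} (ht : 0 < t) :
    ∫⁻ x in pball p n t, F x = ENNReal.ofReal (t ^ (n + s)) * ∫⁻ x in pball p n 1, F x := by
  have hmap := Measure.map_addHaar_smul (volume : Measure (Fin n → ℝ)) ht.ne'
  have hind : Measurable ((pball p n t).indicator F) := hF.indicator (measurableSet_pball p n t)
  have e1 : ∫⁻ x, (pball p n t).indicator F (t • x) =
      ENNReal.ofReal (t ^ n)⁻¹ * ∫⁻ x in pball p n t, F x := by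
    rw [← lintegral_map hind (measurable_const_smul t), hmap, lintegral_smul_measure,
      lintegral_indicator (measurableSet_pball p n t), smul_eq_mul, Module.finrank_fin_fun,
      abs_of_pos (by positivity)]
  have e2 : ∀ x, (pball p n t).indicator F (t • x) =
      (pball p n 1).indicator (fun x => ENNReal.ofReal (t ^ s) * F x) x := fun x => by
    by_cases hx : x ∈ pball p n 1
    · rw [Set.indicator_of_mem ((smul_mem_pball_iff hp ht x).2 hx), Set.indicator_of_mem hx,
        hFs t ht]
    · rw [Set.indicator_of_notMem (fun h => hx ((smul_mem_pball_iff hp ht x).1 h)),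
        Set.indicator_of_notMem hx]
  rw [lintegral_congr e2, lintegral_indicator (measurableSet_pball p n 1),
    lintegral_const_mul _ hF] at e1
  rw [pow_add, ENNReal.ofReal_mul (by positivity), mul_assoc, e1, ← mul_assoc,
    ← ENNReal.ofReal_mul (by positivity), mul_inv_cancel₀ (by positivity)]
  simp

theorem setLIntegral_exp_neg_indicator {a : ℝ} (ha : 0 ≤ a) :
    ∫⁻ u in Set.Ioi (0 : ℝ), (Set.Ici a).indicator (fun u => ENNReal.ofReal (Real.exp (-u))) u =
      ENNReal.ofReal (Real.exp (-a)) := by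
  rw [← lintegral_indicator measurableSet_Ioi]
  have : ∀ᵐ u : ℝ, (Set.Ioi (0 : ℝ)).indicator
      ((Set.Ici a).indicator (fun u => ENNReal.ofReal (Real.exp (-u)))) u =
      (Set.Ioi a).indicator (fun u => ENNReal.ofReal (Real.exp (-u))) u := by
    filter_upwards [compl_mem_ae_iff.2 (measure_singleton (μ := volume) a)] with u hu
    have hne : u ≠ a := hu
    by_cases h : a < u
    · rw [Set.indicator_of_mem (show u ∈ Set.Ioi 0 from lt_of_le_of_lt ha h),
        Set.indicator_of_mem (show u ∈ Set.Ici a from h.le),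
        Set.indicator_of_mem (show u ∈ Set.Ioi a from h)]
    · have h' : ¬ a ≤ u := fun h' => h (lt_of_le_of_ne h' hne.symm)
      rw [Set.indicator_of_notMem (show u ∉ Set.Ioi a from h)]
      simp [Set.indicator, h']
  rw [lintegral_congr_ae this, lintegral_indicator measurableSet_Ioi,
    ← ofReal_integral_eq_lintegral_ofReal (integrableOn_exp_neg_Ioi a)
      (Filter.Eventually.of_forall fun u => (Real.exp_pos _).le), integral_exp_neg_Ioi]

/-- Integrals of homogeneous functions against `exp (-∑ |x i| ^ p)` reduce to integrals over the
unit `L_p` ball. -/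
theorem lintegral_mul_exp_neg_of_homogeneous {p : ℝ} (hp : 1 ≤ p) {n s : ℕ}
    {F : (Fin n → ℝ) → ENNReal} (hF : Measurable F)
    (hFs : ∀ t : ℝ, 0 < t → ∀ x, F (t • x) = ENNReal.ofReal (t ^ s) * F x) :
    ∫⁻ x, F x * ENNReal.ofReal (Real.exp (-∑ i, |x i| ^ p)) =
      ENNReal.ofReal (Real.Gamma ((n + s : ℕ) / p + 1)) * ∫⁻ x in pball p n 1, F x := by
  have hp0 : 0 < p := by linarith
  have hN : ∀ x : Fin n → ℝ, 0 ≤ ∑ i, |x i| ^ p := fun x =>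
    Finset.sum_nonneg fun i _ => by positivity
  have hmeas : Measurable (Function.uncurry fun (x : Fin n → ℝ) (u : ℝ) =>
      F x * (Set.Ici (∑ i, |x i| ^ p)).indicator (fun u => ENNReal.ofReal (Real.exp (-u))) u) := by
    have hset : MeasurableSet {q : (Fin n → ℝ) × ℝ | ∑ i, |q.1 i| ^ p ≤ q.2} :=
      measurableSet_le (by fun_prop) (by fun_prop)
    have := (hF.comp measurable_fst).mul (Measurable.indicator (f := fun q : (Fin n → ℝ) × ℝ =>
      ENNReal.ofReal (Real.exp (-q.2))) (by fun_prop) hset)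
    exact this
  have hball : ∀ u ∈ Set.Ioi (0 : ℝ), ∫⁻ x, F x *
      (Set.Ici (∑ i, |x i| ^ p)).indicator (fun u => ENNReal.ofReal (Real.exp (-u))) u =
      ENNReal.ofReal (Real.exp (-u) * u ^ (((n + s : ℕ) / p + 1 : ℝ) - 1)) *
        ∫⁻ x in pball p n 1, F x := by
    intro u hu
    have hu0 : 0 < u := hu
    have hup : (u ^ (1 / p)) ^ p = u := by
      rw [← Real.rpow_mul hu0.le, one_div_mul_cancel hp0.ne', Real.rpow_one]
    have ht : 0 < u ^ (1 / p) := by positivity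
    have e : ∀ x, F x * (Set.Ici (∑ i, |x i| ^ p)).indicator
        (fun u => ENNReal.ofReal (Real.exp (-u))) u =
        ENNReal.ofReal (Real.exp (-u)) * (pball p n (u ^ (1 / p))).indicator F x := fun x => by
      rw [pball_eq hp n ht.le, hup]
      by_cases h : ∑ i, |x i| ^ p ≤ u
      · simp [Set.indicator, h, mul_comm]
      · simp [Set.indicator, h]
    rw [lintegral_congr e, lintegral_const_mul _ (hF.indicator (measurableSet_pball p n _)),
      lintegral_indicator (measurableSet_pball p n _),
      setLIntegral_pball_of_homogeneous hp hF hFs ht, ← mul_assoc,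
      ← ENNReal.ofReal_mul (Real.exp_pos _).le, ← Real.rpow_natCast, ← Real.rpow_mul hu0.le]
    congr 4
    ring
  have e1 : ∀ x, F x * ENNReal.ofReal (Real.exp (-∑ i, |x i| ^ p)) =
      ∫⁻ u in Set.Ioi (0 : ℝ), F x *
        (Set.Ici (∑ i, |x i| ^ p)).indicator (fun u => ENNReal.ofReal (Real.exp (-u))) u :=
    fun x => by
      rw [lintegral_const_mul _ ((by fun_prop : Measurable _).indicator measurableSet_Ici),
        setLIntegral_exp_neg_indicator (hN x)]
  have hs : (0 : ℝ) < (n + s : ℕ) / p + 1 := by positivity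
  rw [lintegral_congr e1, lintegral_lintegral_swap hmeas.aemeasurable,
    setLIntegral_congr_fun measurableSet_Ioi hball, lintegral_mul_const _ (by fun_prop),
    ← ofReal_integral_eq_lintegral_ofReal (Real.GammaIntegral_convergent hs)
      ((ae_restrict_iff' measurableSet_Ioi).2 (Filter.Eventually.of_forall fun u hu => by
        have : (0 : ℝ) < u := hu
        positivity)), ← Real.Gamma_eq_integral hs]

/-- Integrals of homogeneous functions against `exp (-∑ |x i| ^ p)` reduce to integrals over
`L_p` balls. -/
theorem integral_mul_exp_neg_of_homogeneous {p : ℝ} (hp : 1 ≤ p) {n s : ℕ} {z : ℝ} (hz : 0 < z)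
    {F : (Fin n → ℝ) → ℝ} (hF : Measurable F) (hF0 : ∀ x, 0 ≤ F x)
    (hFs : ∀ t : ℝ, 0 < t → ∀ x, F (t • x) = t ^ s * F x) :
    z ^ (n + s) * ∫ x, F x * Real.exp (-∑ i, |x i| ^ p) =
      Real.Gamma ((n + s : ℕ) / p + 1) * ∫ x in pball p n z, F x := by
  have hp0 : 0 < p := by linarith
  have hF' : Measurable fun x => ENNReal.ofReal (F x) := hF.ennreal_ofReal
  have hFs' : ∀ t : ℝ, 0 < t → ∀ x, ENNReal.ofReal (F (t • x)) =
      ENNReal.ofReal (t ^ s) * ENNReal.ofReal (F x) := fun t ht x => by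
    rw [hFs t ht, ENNReal.ofReal_mul (by positivity)]
  have h1 := lintegral_mul_exp_neg_of_homogeneous hp hF' hFs'
  have h2 := setLIntegral_pball_of_homogeneous hp hF' hFs' hz
  have hG : 0 ≤ Real.Gamma ((n + s : ℕ) / p + 1) :=
    (Real.Gamma_pos_of_pos (by positivity)).le
  rw [integral_eq_lintegral_of_nonneg_ae (Filter.Eventually.of_forall fun x =>
      mul_nonneg (hF0 x) (Real.exp_pos _).le) (by fun_prop),
    integral_eq_lintegral_of_nonneg_ae (Filter.Eventually.of_forall hF0)
      hF.aestronglyMeasurable, h2]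
  simp only [ENNReal.ofReal_mul (hF0 _)]
  rw [h1, ENNReal.toReal_mul, ENNReal.toReal_mul, ENNReal.toReal_ofReal hG,
    ENNReal.toReal_ofReal (by positivity)]
  ring

theorem integrable_comp_abs_of_integrableOn_Ioi {g : ℝ → ℝ} (hg : IntegrableOn g (Set.Ioi 0)) :
    Integrable fun y => g |y| := by
  have h1 : IntegrableOn (fun y => g |y|) (Set.Ioi 0) :=
    hg.congr_fun (fun y hy => by rw [abs_of_pos hy]) measurableSet_Ioi
  have h2 : IntegrableOn (fun y => g |y|) (Set.Iic 0) := by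
    rw [← Measure.map_neg_eq_self (volume : Measure ℝ)]
    have m : MeasurableEmbedding fun x : ℝ => -x := (Homeomorph.neg ℝ).measurableEmbedding
    rw [m.integrableOn_map_iff]
    simp_rw [Function.comp_def, abs_neg, Set.neg_preimage, Set.neg_Iic, neg_zero]
    exact Iff.mpr integrableOn_Ici_iff_integrableOn_Ioi h1
  have h3 := h2.union h1
  rwa [Set.Iic_union_Ioi, integrableOn_univ] at h3

open Polynomial in
theorem integrable_eval_mul_exp_neg {p : ℝ} (hp : 0 < p) (q : ℝ[X]) :
    Integrable (fun y : ℝ => q.eval y * Real.exp (-|y| ^ p)) := by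
  simp only [eval_eq_sum_range, Finset.sum_mul, mul_assoc]
  refine integrable_finsetSum _ fun k _ => Integrable.const_mul ?_ _
  have h1 : IntegrableOn (fun x : ℝ => x ^ k * Real.exp (-x ^ p)) (Set.Ioi 0) := by
    simpa using integrableOn_rpow_mul_exp_neg_rpow (p := p) (s := k)
      (by linarith [k.cast_nonneg (α := ℝ)]) hp
  have h2 : Integrable (fun y : ℝ => |y| ^ k * Real.exp (-|y| ^ p)) :=
    integrable_comp_abs_of_integrableOn_Ioi h1
  refine h2.mono (by fun_prop) (Filter.Eventually.of_forall fun y => ?_)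
  simp

theorem exp_neg_abs_rpow_le {p : ℝ} (hp : 1 ≤ p) (y : ℝ) :
    Real.exp (-|y| ^ p) ≤ Real.exp 1 * Real.exp (-|y| ^ (1 : ℝ)) := by
  rw [← Real.exp_add, Real.exp_le_exp, Real.rpow_one]
  rcases le_total 1 |y| with h | h
  · have := Real.rpow_le_rpow_of_exponent_le h hp
    rw [Real.rpow_one] at this
    linarith
  · have : 0 ≤ |y| ^ p := by positivity
    linarith

theorem exp_neg_one_le_exp_neg_abs_rpow {p : ℝ} (hp : 1 ≤ p) {y : ℝ}
    (hy : y ∈ Set.Icc (-1 : ℝ) 1) : Real.exp (-1) ≤ Real.exp (-|y| ^ p) := by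
  rw [Real.exp_le_exp, neg_le_neg_iff]
  exact Real.rpow_le_one (abs_nonneg y) (abs_le.2 hy) (by linarith)

open Polynomial in
theorem integrable_eval_mul_indicator (q : ℝ[X]) :
    Integrable (fun y : ℝ => q.eval y * (Set.Icc (-1 : ℝ) 1).indicator 1 y) := by
  have : (fun y : ℝ => q.eval y * (Set.Icc (-1 : ℝ) 1).indicator 1 y) =
      (Set.Icc (-1 : ℝ) 1).indicator fun y => q.eval y := by
    ext y
    by_cases h : y ∈ Set.Icc (-1 : ℝ) 1 <;> simp [Set.indicator, h]
  rw [this, integrable_indicator_iff measurableSet_Icc]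
  exact q.continuous.continuousOn.integrableOn_compact isCompact_Icc

open Polynomial in
/-- Monic polynomials of degree at most `d` have square integrals against `exp (-|y| ^ p)` bounded
below by the total mass, uniformly in `p ≥ 1`. -/
theorem exists_mul_le_momentFunctional_sq (d : ℕ) : ∃ κ : ℝ, 0 < κ ∧ κ ≤ 1 ∧
    ∀ (p : ℝ) (_ : 1 ≤ p) (hw : ∀ q : ℝ[X], Integrable fun y => q.eval y * Real.exp (-|y| ^ p)),
      ∀ k ≤ d, ∀ q : ℝ[X], q.Monic → q.natDegree = k →
        κ * ∫ y : ℝ, Real.exp (-|y| ^ p) ≤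
          momentFunctional (fun y => Real.exp (-|y| ^ p)) hw (q * q) := by
  choose m hm0 hm using exists_le_apply_sq_of_monic
    (momentFunctional _ integrable_eval_mul_indicator)
    (momentFunctional_mul_self_pos _ (fun y => Set.indicator_nonneg (by simp) y)
      (fun y hy => by rw [Set.indicator_of_mem (Set.Ioo_subset_Icc_self hy)]; simp))
  set m' := (Finset.range (d + 1)).inf' Finset.nonempty_range_add_one m
  have hm' : 0 < m' := (Finset.lt_inf'_iff _).2 fun k _ => hm0 k
  have hint : ∀ p : ℝ, 1 ≤ p → Integrable fun y : ℝ => Real.exp (-|y| ^ p) := fun p hp => by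
    simpa using integrable_eval_mul_exp_neg (by linarith : 0 < p) 1
  set M := Real.exp 1 * ∫ y : ℝ, Real.exp (-|y| ^ (1 : ℝ)) with hMdef
  have hM : 0 < M :=
    mul_pos (Real.exp_pos 1) (integral_exp_pos (hint 1 le_rfl))
  have hmass : ∀ p : ℝ, 1 ≤ p → ∫ y : ℝ, Real.exp (-|y| ^ p) ≤ M := fun p hp => by
    rw [hMdef, ← integral_const_mul]
    exact integral_mono (hint p hp) ((hint 1 le_rfl).const_mul _) (exp_neg_abs_rpow_le hp)
  refine ⟨min 1 (Real.exp (-1) * m' / M), by positivity, min_le_left _ _,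
    fun p hp hw k hk q hq hqk => ?_⟩
  have h1 : m' ≤ _ := (Finset.inf'_le m (Finset.mem_range.2 (Nat.lt_succ_of_le hk))).trans
    (hm k q hq hqk)
  calc min 1 (Real.exp (-1) * m' / M) * ∫ y : ℝ, Real.exp (-|y| ^ p)
      ≤ Real.exp (-1) * m' / M * M := by
        gcongr
        · exact min_le_right _ _
        · exact hmass p hp
    _ = Real.exp (-1) * m' := by field_simp
    _ ≤ Real.exp (-1) * momentFunctional _ integrable_eval_mul_indicator (q * q) := by gcongr
    _ = ∫ y, Real.exp (-1) * ((q * q).eval y * (Set.Icc (-1 : ℝ) 1).indicator 1 y) :=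
        (integral_const_mul _ _).symm
    _ ≤ ∫ y, (q * q).eval y * Real.exp (-|y| ^ p) := by
        refine integral_mono ((integrable_eval_mul_indicator _).const_mul _) (hw _) fun y => ?_
        have hq0 : 0 ≤ (q * q).eval y := by rw [eval_mul]; exact mul_self_nonneg _
        by_cases h : y ∈ Set.Icc (-1 : ℝ) 1
        · simp only [Set.indicator_of_mem h, Pi.one_apply, mul_one]
          rw [mul_comm]
          exact mul_le_mul_of_nonneg_left (exp_neg_one_le_exp_neg_abs_rpow hp h) hq0
        · simp only [Set.indicator_of_notMem h, mul_zero]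
          exact mul_nonneg hq0 (Real.exp_pos _).le

/-- The second moment of `exp (-|y| ^ p)` is bounded by its mass, uniformly in `p ≥ 1`. -/
theorem exists_mul_integral_sq_le : ∃ ρ > 0, ∀ p : ℝ, 1 ≤ p →
    ρ * ∫ y : ℝ, y ^ 2 * Real.exp (-|y| ^ p) ≤ ∫ y : ℝ, Real.exp (-|y| ^ p) := by
  have hint : ∀ p : ℝ, 1 ≤ p → Integrable fun y : ℝ => y ^ 2 * Real.exp (-|y| ^ p) :=
    fun p hp => (integrable_eval_mul_exp_neg (by linarith : 0 < p) (Polynomial.X ^ 2)).congr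
      (Filter.Eventually.of_forall fun y => by simp only [Polynomial.eval_pow, Polynomial.eval_X])
  have hint0 : ∀ p : ℝ, 1 ≤ p → Integrable fun y : ℝ => Real.exp (-|y| ^ p) := fun p hp => by
    simpa using integrable_eval_mul_exp_neg (by linarith : 0 < p) 1
  set M := Real.exp 1 * ∫ y : ℝ, y ^ 2 * Real.exp (-|y| ^ (1 : ℝ)) with hMdef
  have hM : 0 ≤ M := mul_nonneg (Real.exp_pos 1).le (integral_nonneg fun y => by positivity)
  refine ⟨Real.exp (-1) / (M + 1), by positivity, fun p hp => ?_⟩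
  have h1 : ∫ y : ℝ, y ^ 2 * Real.exp (-|y| ^ p) ≤ M := by
    rw [hMdef, ← integral_const_mul]
    refine integral_mono (hint p hp) ((hint 1 le_rfl).const_mul _) fun y => ?_
    calc y ^ 2 * Real.exp (-|y| ^ p)
        ≤ y ^ 2 * (Real.exp 1 * Real.exp (-|y| ^ (1 : ℝ))) := by
          gcongr; exact exp_neg_abs_rpow_le hp y
      _ = _ := by ring
  have h2 : Real.exp (-1) ≤ ∫ y : ℝ, Real.exp (-|y| ^ p) := by
    calc Real.exp (-1) ≤ ∫ _ in Set.Icc (-1 : ℝ) 1, Real.exp (-1) := by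
          simp only [setIntegral_const, smul_eq_mul, Real.volume_real_Icc]
          norm_num
          linarith [Real.exp_pos (-1)]
      _ ≤ ∫ y in Set.Icc (-1 : ℝ) 1, Real.exp (-|y| ^ p) :=
          setIntegral_mono_on (by simp) (hint0 p hp).integrableOn measurableSet_Icc
            fun y hy => exp_neg_one_le_exp_neg_abs_rpow hp hy
      _ ≤ _ := setIntegral_le_integral (hint0 p hp)
          (Filter.Eventually.of_forall fun y => (Real.exp_pos _).le)
  refine le_trans ?_ h2
  rw [div_mul_eq_mul_div, div_le_iff₀ (by positivity)]
  gcongr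
  linarith

theorem integral_unif {n : ℕ} (s : Set (Fin n → ℝ)) (g : (Fin n → ℝ) → ℝ) :
    ∫ x, g x ∂(unif s) = (volume.real s)⁻¹ * ∫ x in s, g x := by
  rw [unif, integral_smul_measure, ENNReal.toReal_inv, smul_eq_mul, Measure.real]

theorem MvPolynomial.IsHomogeneous.eval_smul {n d : ℕ} {f : MvPolynomial (Fin n) ℝ}
    (hf : f.IsHomogeneous d) (t : ℝ) (x : Fin n → ℝ) :
    MvPolynomial.eval (t • x) f = t ^ d * MvPolynomial.eval x f := by
  simp only [MvPolynomial.eval_eq', Finset.mul_sum]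
  refine Finset.sum_congr rfl fun I hI => ?_
  have hI' : ∑ i, I i = d := by
    rw [← hf (MvPolynomial.mem_support_iff.1 hI), ← Finsupp.degree_eq_sum]
    exact DFunLike.congr_fun Finsupp.degree_eq_weight_one I
  simp only [Pi.smul_apply, smul_eq_mul, mul_pow, Finset.prod_mul_distrib,
    Finset.prod_pow_eq_pow_sum, hI']
  ring

theorem coeffd_sq_le {n d : ℕ} (f : MvPolynomial (Fin n) ℝ) :
    coeffd d f ^ 2 ≤ ∑ I ∈ f.support, f.coeff I ^ 2 := by
  rw [coeffd, Real.sq_sqrt (Finset.sum_nonneg fun _ _ => sq_nonneg _)]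
  exact Finset.sum_le_sum_of_subset_of_nonneg (Finset.filter_subset _ _)
    fun _ _ _ => sq_nonneg _

/-- The normalization of the isotropic `L_p` ball in terms of Gamma values. -/
theorem Gamma_div_Gamma_eq_of_isotropic {p : ℝ} (hp : 1 ≤ p) {n : ℕ} {z : ℝ} (hz : 0 < z)
    (i : Fin n) (hi : ∫ x, x i * x i ∂(unif (pball p n z)) = 1) :
    Real.Gamma (n / p + 1 + 2 / p) / Real.Gamma (n / p + 1) * ∫ y : ℝ, Real.exp (-|y| ^ p) =
      z ^ 2 * ∫ y : ℝ, y ^ 2 * Real.exp (-|y| ^ p) := by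
  have hp0 : 0 < p := by linarith
  have hw := integrable_eval_mul_exp_neg hp0
  have hexp : ∀ x : Fin n → ℝ, Real.exp (-∑ i, |x i| ^ p) = ∏ i, Real.exp (-|x i| ^ p) :=
    fun x => by rw [← Finset.sum_neg_distrib, Real.exp_sum]
  have hZ : 0 < ∫ y : ℝ, Real.exp (-|y| ^ p) := integral_exp_pos (by simpa using hw 1)
  have hg : 0 < Real.Gamma (n / p + 1) := Real.Gamma_pos_of_pos (by positivity)
  have m0 := integral_mul_exp_neg_of_homogeneous hp hz (n := n) (s := 0) (F := fun _ => 1)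
    (by fun_prop) (by simp) (by simp)
  have m2 := integral_mul_exp_neg_of_homogeneous hp hz (n := n) (s := 2)
    (F := fun x => x i * x i) (by fun_prop) (fun x => mul_self_nonneg _)
    (fun t _ x => by simp only [Pi.smul_apply, smul_eq_mul]; ring)
  have q0 := integral_prod_eval_mul_prod (n := n) hw fun _ => 1
  have q2 := integral_prod_eval_mul_prod (n := n) hw
    (Function.update (fun _ => 1) i (Polynomial.X * Polynomial.X))
  have L1 : momentFunctional _ hw 1 = ∫ y : ℝ, Real.exp (-|y| ^ p) := by
    simp [momentFunctional]
  have LX : momentFunctional _ hw (Polynomial.X * Polynomial.X) =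
      ∫ y : ℝ, y ^ 2 * Real.exp (-|y| ^ p) := by
    simp [momentFunctional, sq]
  have e2 : ∀ x : Fin n → ℝ, ∏ j, (Function.update (fun _ => (1 : Polynomial ℝ)) i
      (Polynomial.X * Polynomial.X) j).eval (x j) = x i * x i := fun x => by
    rw [Finset.prod_eq_single i]
    · simp
    · intro j _ hj
      simp [Function.update_of_ne hj]
    · simp
  have p2 : (∏ j, momentFunctional _ hw (Function.update (fun _ => (1 : Polynomial ℝ)) i
      (Polynomial.X * Polynomial.X) j)) * ∫ y : ℝ, Real.exp (-|y| ^ p) =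
      (∫ y : ℝ, y ^ 2 * Real.exp (-|y| ^ p)) * (∫ y : ℝ, Real.exp (-|y| ^ p)) ^ n := by
    have : ∀ c : ℝ, c ^ n = c * ∏ j ∈ Finset.univ.erase i, c := fun c => by
      rw [Finset.mul_prod_erase Finset.univ (fun _ => c) (Finset.mem_univ i)]
      simp
    rw [← Finset.mul_prod_erase Finset.univ _ (Finset.mem_univ i), this,
      Finset.prod_congr rfl fun j hj => by
        rw [Function.update_of_ne (Finset.ne_of_mem_erase hj), L1]]
    rw [Function.update_self, LX]
    ring
  simp only [e2] at q2
  simp only [hexp] at m0 m2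
  rw [q2] at m2
  simp only [Polynomial.eval_one, Finset.prod_const_one, L1, Finset.prod_const, Finset.card_univ,
    Fintype.card_fin] at q0
  rw [q0] at m0
  simp only [integral_const, add_zero, smul_eq_mul, mul_one, measureReal_restrict_apply_univ]
    at m0
  rw [integral_unif] at hi
  have hV : volume.real (pball p n z) ≠ 0 := fun h => by simp [h] at hi
  rw [inv_mul_eq_iff_eq_mul₀ hV, mul_one] at hi
  rw [hi] at m2
  have ea : ((n + 2 : ℕ) / p + 1 : ℝ) = n / p + 1 + 2 / p := by push_cast; ring
  rw [ea] at m2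
  set Z := ∫ y : ℝ, Real.exp (-|y| ^ p)
  set S := ∫ y : ℝ, y ^ 2 * Real.exp (-|y| ^ p)
  set V := volume.real (pball p n z)
  rw [div_mul_eq_mul_div, div_eq_iff hg.ne']
  have h1 : Real.Gamma (n / p + 1 + 2 / p) * Z * V =
      z ^ 2 * S * Real.Gamma (n / p + 1) * V := by
    calc _ = (Real.Gamma (n / p + 1 + 2 / p) * V) * Z := by ring
      _ = z ^ (n + 2) * (S * Z ^ n) := by rw [← m2, ← p2]; ring
      _ = z ^ 2 * S * (z ^ n * Z ^ n) := by ring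
      _ = _ := by rw [m0]; ring
  exact mul_right_cancel₀ hV h1

/-- second-moment lower bound for homogeneous polynomials on isotropic
`L_p` balls, with a constant depending only on the degree `d`. -/
theorem stmt2 (d : ℕ) :
    ∃ C > 0, ∀ (p : ℝ), 1 ≤ p → ∀ (n : ℕ) (z : ℝ), 0 < z →
      -- `z` is the isotropic normalization: the uniform measure on `z • B_{p,n}`
      -- has identity covariance matrix
      (∀ i j : Fin n, ∫ x, x i * x j ∂(unif (pball p n z)) =
          if i = j then 1 else 0) →
      ∀ f : MvPolynomial (Fin n) ℝ, f.IsHomogeneous d →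
        ∫ x, (MvPolynomial.eval x f) ^ 2 ∂(unif (pball p n z)) ≥
          C * coeffd d f ^ 2 := by
  obtain ⟨κ, hκ, hκ1, hmin⟩ := exists_mul_le_momentFunctional_sq d
  obtain ⟨ρ, hρ, hsec⟩ := exists_mul_integral_sq_le
  obtain ⟨K, hK, hGam⟩ := exists_Gamma_add_nat_mul_le d
  refine ⟨(κ * ρ) ^ d / K, by positivity, fun p hp n z hz hiso f hf => ?_⟩
  have hp0 : 0 < p := by linarith
  have hw := integrable_eval_mul_exp_neg hp0
  have hZ : 0 < ∫ y : ℝ, Real.exp (-|y| ^ p) := integral_exp_pos (by simpa using hw 1)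
  have hexp : ∀ x : Fin n → ℝ, Real.exp (-∑ i, |x i| ^ p) = ∏ i, Real.exp (-|x i| ^ p) :=
    fun x => by rw [← Finset.sum_neg_distrib, Real.exp_sum]
  have hnn : 0 ≤ ∫ x, (MvPolynomial.eval x f) ^ 2 ∂(unif (pball p n z)) :=
    integral_nonneg fun x => sq_nonneg _
  by_cases hdn : d ≠ 0 ∧ n = 0
  · obtain ⟨hd, rfl⟩ := hdn
    have : coeffd d f = 0 := by
      rw [coeffd, Finset.filter_false_of_mem fun I _ => by simpa using hd.symm]
      simp
    simpa [this] using hnn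
  have hratio : (Real.Gamma (n / p + 1 + 2 / p) / Real.Gamma (n / p + 1)) ^ d ≤
      (z ^ 2 / ρ) ^ d := by
    rcases Nat.eq_zero_or_pos d with rfl | hd
    · simp
    have hn : 0 < n := Nat.pos_of_ne_zero fun h => hdn ⟨hd.ne', h⟩
    have h := Gamma_div_Gamma_eq_of_isotropic hp hz ⟨0, hn⟩ (by simpa using hiso ⟨0, hn⟩ ⟨0, hn⟩)
    have g0 : 0 < Real.Gamma (n / p + 1) := Real.Gamma_pos_of_pos (by positivity)
    have g2 : 0 < Real.Gamma (n / p + 1 + 2 / p) := Real.Gamma_pos_of_pos (by positivity)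
    refine pow_le_pow_left₀ (by positivity) ?_ d
    rw [le_div_iff₀ hρ]
    refine le_of_mul_le_mul_right ?_ hZ
    calc _ = ρ * (Real.Gamma (n / p + 1 + 2 / p) / Real.Gamma (n / p + 1) *
          ∫ y : ℝ, Real.exp (-|y| ^ p)) := by ring
      _ = z ^ 2 * (ρ * ∫ y : ℝ, y ^ 2 * Real.exp (-|y| ^ p)) := by rw [h]; ring
      _ ≤ _ := mul_le_mul_of_nonneg_left (hsec p hp) (sq_nonneg z)
  have hG := (hGam (n / p + 1) (2 / p) (by simpa using by positivity) (by positivity)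
    (by rw [div_le_iff₀ hp0]; linarith)).trans (mul_le_mul_of_nonneg_left hratio hK.le)
  have g0 : 0 < Real.Gamma (n / p + 1) := Real.Gamma_pos_of_pos (by positivity)
  have gd : 0 < Real.Gamma (n / p + 1 + d * (2 / p)) := Real.Gamma_pos_of_pos (by positivity)
  have m0 := integral_mul_exp_neg_of_homogeneous hp hz (n := n) (s := 0) (F := fun _ => 1)
    (by fun_prop) (by simp) (by simp)
  have md := integral_mul_exp_neg_of_homogeneous hp hz (n := n) (s := 2 * d)
    (F := fun x => MvPolynomial.eval x f ^ 2)
    ((MvPolynomial.continuous_eval f).measurable.pow_const 2) (fun x => sq_nonneg _)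
    (fun t _ x => by rw [hf.eval_smul]; ring)
  have q0 := integral_prod_eval_mul_prod (n := n) hw fun _ => 1
  have L1 : momentFunctional _ hw 1 = ∫ y : ℝ, Real.exp (-|y| ^ p) := by
    simp [momentFunctional]
  have low := le_integral_sq_mul_prod hw (fun y => (Real.exp_pos _).le)
    (fun y _ => Real.exp_pos _) hκ hκ1 (hmin p hp hw) f hf
  simp only [Polynomial.eval_one, Finset.prod_const_one, L1, Finset.prod_const, Finset.card_univ,
    Fintype.card_fin] at q0
  simp only [hexp] at m0 md
  rw [q0] at m0
  simp only [integral_const, add_zero, smul_eq_mul, mul_one, measureReal_restrict_apply_univ]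
    at m0
  have ea : ((n + 2 * d : ℕ) / p + 1 : ℝ) = n / p + 1 + d * (2 / p) := by push_cast; ring
  rw [ea] at md
  have hV : 0 < volume.real (pball p n z) := by
    have : 0 < Real.Gamma (n / p + 1) * volume.real (pball p n z) := by
      rw [← m0]; positivity
    exact pos_of_mul_pos_right this g0.le
  rw [integral_unif]
  have hcs := coeffd_sq_le (d := d) f
  set Z := ∫ y : ℝ, Real.exp (-|y| ^ p)
  set V := volume.real (pball p n z)
  set A := ∫ x : Fin n → ℝ, MvPolynomial.eval x f ^ 2 * ∏ i, Real.exp (-|x i| ^ p)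
  set E := ∫ x in pball p n z, MvPolynomial.eval x f ^ 2
  set T := ∑ I ∈ f.support, f.coeff I ^ 2
  set γ := Real.Gamma (n / p + 1)
  set γd := Real.Gamma (n / p + 1 + d * (2 / p))
  have hT : 0 ≤ T := Finset.sum_nonneg fun _ _ => sq_nonneg _
  have h1 : z ^ (2 * d) * (κ ^ d * (γ * V) * T) ≤ γd * E := by
    rw [← md, ← m0]
    calc _ = z ^ (n + 2 * d) * (κ ^ d * Z ^ n * T) := by ring
      _ ≤ _ := mul_le_mul_of_nonneg_left low (by positivity)
  have h2 : γd ≤ K * (z ^ 2 / ρ) ^ d * γ := (div_le_iff₀ g0).1 hG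
  have hE : 0 ≤ E := integral_nonneg fun x => sq_nonneg _
  have h3 := h1.trans (mul_le_mul_of_nonneg_right h2 hE)
  have h4 : (κ * ρ) ^ d / K * T ≤ V⁻¹ * E := by
    rw [inv_mul_eq_div, le_div_iff₀ hV, div_mul_eq_mul_div, div_mul_eq_mul_div, div_le_iff₀ hK]
    have hpos : 0 < (z ^ 2 / ρ) ^ d * γ := by positivity
    refine le_of_mul_le_mul_left ?_ hpos
    calc (z ^ 2 / ρ) ^ d * γ * ((κ * ρ) ^ d * T * V)
        = z ^ (2 * d) * (κ ^ d * (γ * V) * T) := by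
          rw [div_pow, mul_pow, pow_mul]; field_simp
      _ ≤ _ := h3
      _ = _ := by ring
  exact le_trans (mul_le_mul_of_nonneg_left hcs (by positivity)) h4
end
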